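/- arXiv:2206.11630 — 2 statements merged into one kernel-verified Lean document; each statement's English description precedes it below -/
import Mathlib

section
/- For every object A of C, the partially ordered class Nsb(A) of normal subobjects of A is a bounded lattice: its least element is ker(id_A), its greatest element is id_A (i.e., im(id_A)), the meet of s, t ∈ Nsb(A) is s ∧ t = s_* s* t, and the join is s ∨ t = coker(t)* coker(t)_* s (which equals coker(s)* coker(s)_* t). -/
open CategoryTheory

universe v u

/-- An ideal of "null morphisms" in a category: closed under composition with
arbitrary morphisms on either side. -/
structure NullIdeal (C : Type u) [Category.{v} C] : Type (max u v) where
  null : ∀ ⦃A B : C⦄, (A ⟶ B) → Prop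
  comp_left : ∀ ⦃A B D : C⦄ (f : A ⟶ B) (g : B ⟶ D), null f → null (f ≫ g)
  comp_right : ∀ ⦃A B D : C⦄ (f : A ⟶ B) (g : B ⟶ D), null g → null (f ≫ g)

variable {C : Type u} [Category.{v} C]

/-- `k : S ⟶ A` is a kernel of `f : A ⟶ B` with respect to the ideal `N`. -/
def IsKer (N : NullIdeal C) {S A B : C} (k : S ⟶ A) (f : A ⟶ B) : Prop :=
  N.null (k ≫ f) ∧ ∀ ⦃T : C⦄ (g : T ⟶ A), N.null (g ≫ f) → ∃! h : T ⟶ S, h ≫ k = g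

/-- `q : B ⟶ Q` is a cokernel of `f : A ⟶ B` with respect to the ideal `N`. -/
def IsCoker (N : NullIdeal C) {A B Q : C} (f : A ⟶ B) (q : B ⟶ Q) : Prop :=
  N.null (f ≫ q) ∧ ∀ ⦃T : C⦄ (g : B ⟶ T), N.null (f ≫ g) → ∃! h : Q ⟶ T, q ≫ h = g

/-- A normal monomorphism is a morphism which is a kernel of some morphism. -/
def IsNormalMonoN (N : NullIdeal C) {S A : C} (s : S ⟶ A) : Prop :=
  ∃ (B : C) (f : A ⟶ B), IsKer N s f

/-- A normal epimorphism is a morphism which is a cokernel of some morphism. -/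
def IsNormalEpiN (N : NullIdeal C) {A Q : C} (q : A ⟶ Q) : Prop :=
  ∃ (B : C) (f : B ⟶ A), IsCoker N f q

/-- A choice of kernels and cokernels for all morphisms, w.r.t. the ideal `N`. -/
structure KernelChoice (N : NullIdeal C) where
  Ker : ∀ {A B : C}, (A ⟶ B) → C
  ker : ∀ {A B : C} (f : A ⟶ B), Ker f ⟶ A
  isKer : ∀ {A B : C} (f : A ⟶ B), IsKer N (ker f) f
  Coker : ∀ {A B : C}, (A ⟶ B) → C
  coker : ∀ {A B : C} (f : A ⟶ B), B ⟶ Coker f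
  isCoker : ∀ {A B : C} (f : A ⟶ B), IsCoker N f (coker f)

/-- Factorization (pre)order on (normal) subobjects of `A`. -/
def SubLe {S T A : C} (s : S ⟶ A) (t : T ⟶ A) : Prop := ∃ h : S ⟶ T, h ≫ t = s

/-- Two monomorphisms into `A` represent the same subobject of `A`. -/
def SubEquiv {S T A : C} (s : S ⟶ A) (t : T ⟶ A) : Prop := ∃ φ : S ≅ T, φ.hom ≫ t = s

/-- Two epimorphisms out of `A` represent the same quotient object of `A`. -/
def QuotEquiv {A S T : C} (q : A ⟶ S) (r : A ⟶ T) : Prop := ∃ φ : S ≅ T, q ≫ φ.hom = r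

/-- The pullback `f* t = ker (coker t ∘ f)` of a normal subobject `t` along `f`. -/
def pullN {N : NullIdeal C} (K : KernelChoice N) {A B T : C} (f : A ⟶ B) (t : T ⟶ B) :
    K.Ker (f ≫ K.coker t) ⟶ A := K.ker (f ≫ K.coker t)

/-- The pushforward `f_* s = im (f ∘ s) = ker (coker (f ∘ s))` of a normal subobject `s`
along `f`. -/
def pushN {N : NullIdeal C} (K : KernelChoice N) {A B S : C} (f : A ⟶ B) (s : S ⟶ A) :
    K.Ker (K.coker (s ≫ f)) ⟶ B := K.ker (K.coker (s ≫ f))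

/-- The image `im f = ker (coker f)`. -/
def imN {N : NullIdeal C} (K : KernelChoice N) {A B : C} (f : A ⟶ B) :
    K.Ker (K.coker f) ⟶ B := K.ker (K.coker f)

/-- The meet `s ∧ t = s_* s* t` of two normal subobjects of `A`. -/
def meetN {N : NullIdeal C} (K : KernelChoice N) {A S T : C} (s : S ⟶ A) (t : T ⟶ A) :=
  pushN K s (pullN K s t)

/-- The join `s ∨ t = (coker t)* (coker t)_* s` of two normal subobjects of `A`. -/
def joinN {N : NullIdeal C} (K : KernelChoice N) {A S T : C} (s : S ⟶ A) (t : T ⟶ A) :=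
  pullN K (K.coker t) (pushN K (K.coker t) s)

namespace IsKer

variable {N : NullIdeal C} {S A B : C} {k : S ⟶ A} {f : A ⟶ B}

theorem isNormalMonoN (hk : IsKer N k f) : IsNormalMonoN N k := ⟨B, f, hk⟩

theorem subLe_iff (hk : IsKer N k f) {U : C} (u : U ⟶ A) : SubLe u k ↔ N.null (u ≫ f) := by
  refine ⟨?_, fun hu => (hk.2 u hu).exists⟩
  rintro ⟨h, rfl⟩
  simpa using N.comp_right h _ hk.1

end IsKer

theorem IsNormalMonoN.mono {N : NullIdeal C} {S A : C} {s : S ⟶ A}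
    (hs : IsNormalMonoN N s) : Mono s := by
  obtain ⟨B, f, hf⟩ := hs
  refine ⟨fun g h e => ?_⟩
  exact (hf.2 (h ≫ s) ((hf.subLe_iff _).1 ⟨h, rfl⟩)).unique e rfl

theorem SubLe.refl {A S : C} (s : S ⟶ A) : SubLe s s := ⟨𝟙 _, Category.id_comp s⟩

theorem SubLe.antisymm {S T A : C} {s : S ⟶ A} {t : T ⟶ A} [Mono s] [Mono t]
    (hst : SubLe s t) (hts : SubLe t s) : SubEquiv s t := by
  obtain ⟨h, rfl⟩ := hst
  obtain ⟨k, hk⟩ := hts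
  refine ⟨⟨h, k, ?_, ?_⟩, rfl⟩
  · rw [← cancel_mono (h ≫ t)]
    simp [hk]
  · rw [← cancel_mono t]
    simpa using hk

theorem IsCoker.null_comp_iff {N : NullIdeal C} {A B Q D : C} {f : A ⟶ B} {q : B ⟶ Q}
    (hq : IsCoker N f q) (g : B ⟶ D) : N.null (f ≫ g) ↔ ∃ h : Q ⟶ D, q ≫ h = g := by
  refine ⟨fun hg => (hq.2 g hg).exists, ?_⟩
  rintro ⟨h, rfl⟩
  simpa using N.comp_left _ h hq.1

section KernelChoice

variable {N : NullIdeal C} (K : KernelChoice N)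

theorem subLe_imN {A B : C} (f : A ⟶ B) : SubLe f (imN K f) :=
  ((K.isKer _).subLe_iff f).2 (K.isCoker f).1

/-- A morphism out of `B` annihilates the image of `f` exactly when it annihilates `f`. -/
theorem null_imN_comp_iff {A B D : C} (f : A ⟶ B) (g : B ⟶ D) :
    N.null (imN K f ≫ g) ↔ N.null (f ≫ g) := by
  constructor
  · intro hg
    obtain ⟨h, hh⟩ := subLe_imN K f
    rw [← hh, Category.assoc]
    exact N.comp_right h _ hg
  · intro hg
    obtain ⟨h, rfl⟩ := ((K.isCoker f).null_comp_iff g).1 hg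
    simpa [imN] using N.comp_left _ h (K.isKer (K.coker f)).1

/-- The image of `f` is the least normal subobject through which `f` factors. -/
theorem imN_subLe_iff {A B U : C} (f : A ⟶ B) {u : U ⟶ B} (hu : IsNormalMonoN N u) :
    SubLe (imN K f) u ↔ SubLe f u := by
  obtain ⟨D, g, hg⟩ := hu
  rw [hg.subLe_iff, hg.subLe_iff, null_imN_comp_iff]

/-- A normal monomorphism is a kernel of its cokernel. -/
theorem IsNormalMonoN.subLe_iff {S A U : C} {s : S ⟶ A} (hs : IsNormalMonoN N s) (u : U ⟶ A) :
    SubLe u s ↔ N.null (u ≫ K.coker s) := by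
  constructor
  · rintro ⟨h, rfl⟩
    simpa using N.comp_right h _ (K.isCoker s).1
  · intro hu
    obtain ⟨k, hk⟩ := ((K.isKer _).subLe_iff u).2 hu
    obtain ⟨l, hl⟩ := (imN_subLe_iff K s hs).2 (SubLe.refl s)
    exact ⟨k ≫ l, by rw [Category.assoc, hl]; exact hk⟩

/-- The pullback is characterised by the universal property of a pullback. -/
theorem subLe_pullN_iff {A B T U : C} (f : A ⟶ B) {t : T ⟶ B} (ht : IsNormalMonoN N t)
    (u : U ⟶ A) : SubLe u (pullN K f t) ↔ SubLe (u ≫ f) t := by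
  rw [ht.subLe_iff K, Category.assoc]
  exact (K.isKer _).subLe_iff u

theorem isNormalMonoN_pushN {A B S : C} (f : A ⟶ B) (s : S ⟶ A) :
    IsNormalMonoN N (pushN K f s) := (K.isKer _).isNormalMonoN

theorem isNormalMonoN_joinN {A S T : C} (s : S ⟶ A) (t : T ⟶ A) :
    IsNormalMonoN N (joinN K s t) := (K.isKer _).isNormalMonoN

theorem subLe_meetN {A S T U : C} {s : S ⟶ A} {t : T ⟶ A} (ht : IsNormalMonoN N t)
    {u : U ⟶ A} (hus : SubLe u s) (hut : SubLe u t) : SubLe u (meetN K s t) := by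
  obtain ⟨a, rfl⟩ := hus
  obtain ⟨b, rfl⟩ := (subLe_pullN_iff K s ht a).2 hut
  obtain ⟨c, hc⟩ := subLe_imN K (pullN K s t ≫ s)
  refine ⟨b ≫ c, ?_⟩
  rw [Category.assoc, Category.assoc]
  exact congrArg (b ≫ ·) hc

theorem meetN_subLe_left {A S T : C} {s : S ⟶ A} (hs : IsNormalMonoN N s) (t : T ⟶ A) :
    SubLe (meetN K s t) s :=
  (imN_subLe_iff K _ hs).2 ⟨_, rfl⟩

theorem meetN_subLe_right {A S T : C} (s : S ⟶ A) {t : T ⟶ A} (ht : IsNormalMonoN N t) :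
    SubLe (meetN K s t) t :=
  (imN_subLe_iff K _ ht).2 ((subLe_pullN_iff K s ht _).1 (SubLe.refl _))

theorem subLe_joinN_left {A S T : C} (s : S ⟶ A) (t : T ⟶ A) : SubLe s (joinN K s t) :=
  (subLe_pullN_iff K _ (isNormalMonoN_pushN K _ s) s).2 (subLe_imN K _)

theorem subLe_joinN_right {A S T : C} (s : S ⟶ A) (t : T ⟶ A) : SubLe t (joinN K s t) := by
  refine ((K.isKer _).subLe_iff t).2 ?_
  rw [← Category.assoc]
  exact N.comp_left _ _ (K.isCoker t).1

theorem joinN_subLe {A S T U : C} {s : S ⟶ A} {t : T ⟶ A} {u : U ⟶ A}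
    (hu : IsNormalMonoN N u) (hsu : SubLe s u) (htu : SubLe t u) : SubLe (joinN K s t) u := by
  obtain ⟨D, g, hg⟩ := hu
  rw [hg.subLe_iff] at hsu htu ⊢
  obtain ⟨h, rfl⟩ := ((K.isCoker t).null_comp_iff g).1 htu
  rw [← Category.assoc] at hsu
  obtain ⟨k, rfl⟩ :=
    ((K.isCoker (pushN K (K.coker t) s)).null_comp_iff h).1 ((null_imN_comp_iff K _ h).2 hsu)
  have hj : N.null (joinN K s t ≫ K.coker t ≫ K.coker (pushN K (K.coker t) s)) :=
    (K.isKer _).1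
  simpa using N.comp_left _ k hj

theorem joinN_comm {A S T : C} (s : S ⟶ A) (t : T ⟶ A) :
    SubEquiv (joinN K s t) (joinN K t s) := by
  have := (isNormalMonoN_joinN K s t).mono
  have := (isNormalMonoN_joinN K t s).mono
  exact SubLe.antisymm
    (joinN_subLe K (isNormalMonoN_joinN K t s) (subLe_joinN_right K t s) (subLe_joinN_left K t s))
    (joinN_subLe K (isNormalMonoN_joinN K s t) (subLe_joinN_right K s t) (subLe_joinN_left K s t))

theorem isKer_id_coker_id (A : C) : IsKer N (𝟙 A) (K.coker (𝟙 A)) := by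
  refine ⟨(K.isCoker _).1, fun T g _ => ⟨g, Category.comp_id g, fun h hh => ?_⟩⟩
  simpa using hh

end KernelChoice

/-- `Nsb A` is a bounded lattice: `ker (𝟙 A)` is the least element, `𝟙 A` (equivalently
`im (𝟙 A)`) is the greatest element, `s ∧ t = s_* s* t` is the meet, and
`s ∨ t = (coker t)* (coker t)_* s = (coker s)* (coker s)_* t` is the join. -/
theorem stmt6 (N : NullIdeal C) (K : KernelChoice N) (A : C) :
    -- least element
    (∀ {S : C} (s : S ⟶ A), IsNormalMonoN N s → SubLe (K.ker (𝟙 A)) s) ∧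
    -- greatest element, represented by the identity, which is normal (`𝟙 A = im (𝟙 A)`)
    (∀ {S : C} (s : S ⟶ A), IsNormalMonoN N s → SubLe s (𝟙 A)) ∧
    IsNormalMonoN N (𝟙 A) ∧ SubEquiv (𝟙 A) (imN K (𝟙 A)) ∧
    -- meets
    (∀ {S T : C} (s : S ⟶ A) (t : T ⟶ A), IsNormalMonoN N s → IsNormalMonoN N t →
      SubLe (meetN K s t) s ∧ SubLe (meetN K s t) t ∧
        ∀ {U : C} (u : U ⟶ A), IsNormalMonoN N u → SubLe u s → SubLe u t →
          SubLe u (meetN K s t)) ∧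
    -- joins
    (∀ {S T : C} (s : S ⟶ A) (t : T ⟶ A), IsNormalMonoN N s → IsNormalMonoN N t →
      SubLe s (joinN K s t) ∧ SubLe t (joinN K s t) ∧
        SubEquiv (joinN K s t) (joinN K t s) ∧
        ∀ {U : C} (u : U ⟶ A), IsNormalMonoN N u → SubLe s u → SubLe t u →
          SubLe (joinN K s t) u) := by
  have hid := (isKer_id_coker_id K A).isNormalMonoN
  refine ⟨?_, fun s _ => ⟨s, Category.comp_id s⟩, hid, ?_, ?_, ?_⟩
  · rintro S s ⟨B, f, hf⟩
    rw [hf.subLe_iff]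
    exact N.comp_left _ f (by simpa using (K.isKer (𝟙 A)).1)
  · have : Mono (imN K (𝟙 A)) := (K.isKer _).isNormalMonoN.mono
    exact SubLe.antisymm (subLe_imN K _) ⟨_, Category.comp_id _⟩
  · intro S T s t hs ht
    exact ⟨meetN_subLe_left K hs t, meetN_subLe_right K s ht,
      fun _ _ hus hut => subLe_meetN K ht hus hut⟩
  · intro S T s t _ _
    exact ⟨subLe_joinN_left K s t, subLe_joinN_right K s t, joinN_comm K s t,
      fun _ hu hsu htu => joinN_subLe K hu hsu htu⟩
end

section
/- Let C be a category with an ideal of null morphisms N with respect to which kernels and cokernels exist, and consider the arrow category C→ with the ideal of squares with null diagonal. For every object a : A₀ → A₁ of C→, there are natural order isomorphisms between the lattice of normal subobjects of a in C→ and each of the sets {s ∈ Nsb(A₀) | a* a_* s = s} and {t ∈ Nsb(A₁) | a_* a* t = t}. -/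
open CategoryTheory

universe v u

variable {C : Type u} [Category.{v} C]

/-- The ideal on the arrow category `C→` consisting of the squares whose diagonal is a
null morphism of `C`. -/
def arrowIdeal (N : NullIdeal C) : NullIdeal (Arrow C) where
  null {a b} f := N.null (f.left ≫ b.hom)
  comp_left {a b c} f g hf := by
    show N.null ((f ≫ g).left ≫ c.hom)
    have h : (f ≫ g).left ≫ c.hom = (f.left ≫ b.hom) ≫ g.right := by
      rw [Arrow.comp_left, Category.assoc, Arrow.w g, Category.assoc]
    rw [h]
    exact N.comp_left _ _ hf
  comp_right {a b c} f g hg := by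
    show N.null ((f ≫ g).left ≫ c.hom)
    have h : (f ≫ g).left ≫ c.hom = f.left ≫ (g.left ≫ c.hom) := by
      rw [Arrow.comp_left, Category.assoc]
    rw [h]
    exact N.comp_right _ _ hg

section Kernels

variable {N : NullIdeal C}

theorem SubLe.trans {R S T A : C} {r : R ⟶ A} {s : S ⟶ A} {t : T ⟶ A} (h : SubLe r s)
    (h' : SubLe s t) : SubLe r t := by
  obtain ⟨u, rfl⟩ := h
  obtain ⟨w, rfl⟩ := h'
  exact ⟨u ≫ w, Category.assoc _ _ _⟩

theorem SubEquiv.le {S T A : C} {s : S ⟶ A} {t : T ⟶ A} (h : SubEquiv s t) : SubLe s t :=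
  ⟨h.choose.hom, h.choose_spec⟩

theorem SubEquiv.ge {S T A : C} {s : S ⟶ A} {t : T ⟶ A} (h : SubEquiv s t) : SubLe t s := by
  obtain ⟨φ, rfl⟩ := h
  exact ⟨φ.inv, φ.inv_hom_id_assoc t⟩

theorem IsKer.mono {S A B : C} {k : S ⟶ A} {f : A ⟶ B} (hk : IsKer N k f) : Mono k where
  right_cancellation g h e :=
    (hk.2 (h ≫ k) (by simpa only [Category.assoc] using N.comp_right h _ hk.1)).unique e rfl

theorem IsKer.subLe {S T A B : C} {k : S ⟶ A} {f : A ⟶ B} (hk : IsKer N k f) {g : T ⟶ A}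
    (hg : N.null (g ≫ f)) : SubLe g k :=
  (hk.2 g hg).exists

theorem SubLe.null {S T A B : C} {g : T ⟶ A} {k : S ⟶ A} {f : A ⟶ B} (h : SubLe g k)
    (hk : N.null (k ≫ f)) : N.null (g ≫ f) := by
  obtain ⟨u, rfl⟩ := h
  simpa only [Category.assoc] using N.comp_right u _ hk

theorem IsCoker.null {T A B Q D : C} {f : A ⟶ B} {q : B ⟶ Q} (hq : IsCoker N f q) {r : B ⟶ D}
    (hr : N.null (f ≫ r)) {g : T ⟶ B} (hg : N.null (g ≫ q)) : N.null (g ≫ r) := by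
  obtain ⟨w, rfl⟩ := (hq.2 r hr).exists
  simpa only [Category.assoc] using N.comp_left _ w hg

theorem subEquiv_of_subLe {S T A : C} {s : S ⟶ A} {t : T ⟶ A} [Mono s] [Mono t]
    (h : SubLe s t) (h' : SubLe t s) : SubEquiv s t := by
  obtain ⟨u, hu⟩ := h
  obtain ⟨w, hw⟩ := h'
  exact ⟨⟨u, w, by simp [← cancel_mono s, hu, hw], by simp [← cancel_mono t, hu, hw]⟩, hu⟩

variable (K : KernelChoice N)

instance {A B : C} (f : A ⟶ B) : Mono (K.ker f) := (K.isKer f).mono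

instance {A B S : C} (f : A ⟶ B) (s : S ⟶ A) : Mono (pushN K f s) :=
  inferInstanceAs (Mono (K.ker _))

instance {A B T : C} (f : A ⟶ B) (t : T ⟶ B) : Mono (pullN K f t) :=
  inferInstanceAs (Mono (K.ker _))

theorem pushN_mono {A B S T : C} (f : A ⟶ B) {s : S ⟶ A} {t : T ⟶ A} (h : SubLe s t) :
    SubLe (pushN K f s) (pushN K f t) := by
  refine (K.isKer _).subLe ((K.isCoker (s ≫ f)).null ?_ (K.isKer _).1)
  have := (K.isCoker (t ≫ f)).1
  rw [Category.assoc] at this ⊢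
  exact h.null this

theorem pullN_mono {A B S T : C} (f : A ⟶ B) {s : S ⟶ B} {t : T ⟶ B} (h : SubLe s t) :
    SubLe (pullN K f s) (pullN K f t) := by
  refine (K.isKer _).subLe ?_
  have hs := (K.isKer (f ≫ K.coker s)).1
  rw [← Category.assoc] at hs ⊢
  exact (K.isCoker s).null (h.null (K.isCoker t).1) hs

theorem subLe_pullN_pushN {A B S : C} (f : A ⟶ B) (s : S ⟶ A) :
    SubLe s (pullN K f (pushN K f s)) := by
  refine (K.isKer _).subLe ?_
  rw [← Category.assoc]
  exact ((K.isKer _).subLe (K.isCoker (s ≫ f)).1).null (K.isCoker (pushN K f s)).1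

/-- The kernel of a morphism factoring through `f` is closed under `f* f_*`. -/
theorem IsKer.pullN_pushN {A B D S : C} {f : A ⟶ B} {r : B ⟶ D} {s : S ⟶ A}
    (hs : IsKer N s (f ≫ r)) : SubEquiv (pullN K f (pushN K f s)) s := by
  have := hs.mono
  refine subEquiv_of_subLe (hs.subLe ?_) (subLe_pullN_pushN K f s)
  have hnull : N.null (pushN K f s ≫ r) :=
    (K.isCoker (s ≫ f)).null (by simpa only [Category.assoc] using hs.1) (K.isKer _).1
  have hker := (K.isKer (f ≫ K.coker (pushN K f s))).1
  rw [← Category.assoc] at hker ⊢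
  exact (K.isCoker (pushN K f s)).null hnull hker

end Kernels

section ArrowKernels

variable {N : NullIdeal C}

theorem IsKer.arrow_left {x a b : Arrow C} {m : x ⟶ a} {f : a ⟶ b}
    (hm : IsKer (arrowIdeal N) m f) : IsKer N m.left (a.hom ≫ f.right) := by
  constructor
  · have h : N.null ((m ≫ f).left ≫ b.hom) := hm.1
    simpa only [Arrow.comp_left, Category.assoc, Arrow.w] using h
  · intro T g hg
    let γ : Arrow.mk (𝟙 T) ⟶ a := Arrow.homMk g (g ≫ a.hom) (by simp)
    have hγ : (arrowIdeal N).null (γ ≫ f) := by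
      change N.null ((g ≫ f.left) ≫ b.hom)
      simpa only [Category.assoc, Arrow.w] using hg
    obtain ⟨h, hh, huniq⟩ := hm.2 γ hγ
    refine ⟨h.left, congrArg (fun e => e.left) hh, fun u hu => ?_⟩
    let η : Arrow.mk (𝟙 T) ⟶ x := Arrow.homMk u (u ≫ x.hom) (by simp)
    have hη : η ≫ m = γ := by
      ext
      · exact hu
      · change (u ≫ x.hom) ≫ m.right = g ≫ a.hom
        rw [Category.assoc, ← Arrow.w m, ← Category.assoc, hu]
    exact congrArg (fun e => e.left) (huniq η hη)

theorem IsNormalMonoN.exists_isKer_left {x a : Arrow C} {m : x ⟶ a}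
    (hm : IsNormalMonoN (arrowIdeal N) m) :
    ∃ (D : C) (r : a.right ⟶ D), IsKer N m.left (a.hom ≫ r) := by
  obtain ⟨b, f, hf⟩ := hm
  exact ⟨_, _, hf.arrow_left⟩

theorem IsNormalMonoN.subLe_of_left {x x' a : Arrow C} {m : x ⟶ a} {m' : x' ⟶ a}
    (hm' : IsNormalMonoN (arrowIdeal N) m') (h : SubLe m.left m'.left) : SubLe m m' := by
  obtain ⟨b, f, hf⟩ := hm'
  refine hf.subLe ?_
  change N.null ((m.left ≫ f.left) ≫ b.hom)
  simpa only [Category.assoc, Arrow.w] using h.null hf.arrow_left.1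

theorem SubLe.arrow_left {x x' a : Arrow C} {m : x ⟶ a} {m' : x' ⟶ a} (h : SubLe m m') :
    SubLe m.left m'.left := by
  obtain ⟨u, rfl⟩ := h
  exact ⟨u.left, rfl⟩

/-- The square with left component `s` and right component the identity. -/
def arrowOfLeft (a : Arrow C) {S : C} (s : S ⟶ a.left) : Arrow.mk (s ≫ a.hom) ⟶ a :=
  Arrow.homMk s (𝟙 _) (by simp)

theorem IsKer.isNormalMonoN_arrowOfLeft {a : Arrow C} {S D : C} {s : S ⟶ a.left}
    {r : a.right ⟶ D} (hs : IsKer N s (a.hom ≫ r)) :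
    IsNormalMonoN (arrowIdeal N) (arrowOfLeft a s) := by
  have := hs.mono
  refine ⟨Arrow.mk r, Arrow.homMk a.hom r rfl, ?_, fun y g hg => ?_⟩
  · change N.null ((s ≫ a.hom) ≫ r)
    simpa only [Category.assoc] using hs.1
  · change N.null ((g.left ≫ a.hom) ≫ r) at hg
    rw [Category.assoc] at hg
    obtain ⟨h, hh⟩ := hs.subLe hg
    refine ⟨Arrow.homMk h g.right ?_, ?_, fun w hw => ?_⟩
    · change h ≫ s ≫ a.hom = _
      rw [← Category.assoc, hh, Arrow.w g]
    · ext
      · exact hh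
      · exact Category.comp_id _
    · ext
      · have e : w.left ≫ s = g.left := congrArg (fun e => e.left) hw
        exact (cancel_mono s).1 (e.trans hh.symm)
      · have e : w.right ≫ 𝟙 _ = g.right := congrArg (fun e => e.right) hw
        exact (Category.comp_id _).symm.trans e

end ArrowKernels

/-- For an object `a : A₀ ⟶ A₁` of the arrow category, there are natural order
isomorphisms between the lattice of normal subobjects of `a` in `C→` (with the ideal of
squares with null diagonal) and each of the sets
`{s ∈ Nsb A₀ | a* a_* s = s}` and `{t ∈ Nsb A₁ | a_* a* t = t}`.
The first is given by `m ↦ m.left`, the second by `m ↦ a_* m.left`; "order isomorphism"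
is expressed as: well-definedness, order-reflection in both directions, and essential
surjectivity onto the respective sets of closed normal subobjects. -/
theorem stmt8 (N : NullIdeal C) (K : KernelChoice N) (a : Arrow C) :
    -- the map to the `a* a_*`-closed normal subobjects of `A₀ = a.left`
    ((∀ (x : Arrow C) (m : x ⟶ a), IsNormalMonoN (arrowIdeal N) m →
        IsNormalMonoN N m.left ∧ SubEquiv (pullN K a.hom (pushN K a.hom m.left)) m.left) ∧
      (∀ (x x' : Arrow C) (m : x ⟶ a) (m' : x' ⟶ a),
        IsNormalMonoN (arrowIdeal N) m → IsNormalMonoN (arrowIdeal N) m' →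
        (SubLe m m' ↔ SubLe m.left m'.left)) ∧
      (∀ {S : C} (s : S ⟶ a.left), IsNormalMonoN N s →
        SubEquiv (pullN K a.hom (pushN K a.hom s)) s →
        ∃ (x : Arrow C) (m : x ⟶ a), IsNormalMonoN (arrowIdeal N) m ∧ SubEquiv m.left s)) ∧
    -- the map to the `a_* a*`-closed normal subobjects of `A₁ = a.right`
    ((∀ (x : Arrow C) (m : x ⟶ a), IsNormalMonoN (arrowIdeal N) m →
        IsNormalMonoN N (pushN K a.hom m.left) ∧
        SubEquiv (pushN K a.hom (pullN K a.hom (pushN K a.hom m.left)))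
          (pushN K a.hom m.left)) ∧
      (∀ (x x' : Arrow C) (m : x ⟶ a) (m' : x' ⟶ a),
        IsNormalMonoN (arrowIdeal N) m → IsNormalMonoN (arrowIdeal N) m' →
        (SubLe m m' ↔ SubLe (pushN K a.hom m.left) (pushN K a.hom m'.left))) ∧
      (∀ {T : C} (t : T ⟶ a.right), IsNormalMonoN N t →
        SubEquiv (pushN K a.hom (pullN K a.hom t)) t →
        ∃ (x : Arrow C) (m : x ⟶ a), IsNormalMonoN (arrowIdeal N) m ∧
          SubEquiv (pushN K a.hom m.left) t)) := by
  refine ⟨⟨?_, ?_, ?_⟩, ?_, ?_, ?_⟩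
  · intro x m hm
    obtain ⟨D, r, hr⟩ := hm.exists_isKer_left
    exact ⟨⟨_, _, hr⟩, hr.pullN_pushN K⟩
  · exact fun x x' m m' _ hm' => ⟨SubLe.arrow_left, hm'.subLe_of_left⟩
  · exact fun s _ hs => ⟨_, arrowOfLeft a (pullN K a.hom (pushN K a.hom s)),
      (K.isKer _).isNormalMonoN_arrowOfLeft, hs⟩
  · intro x m hm
    obtain ⟨D, r, hr⟩ := hm.exists_isKer_left
    have h := hr.pullN_pushN K
    exact ⟨⟨_, _, K.isKer _⟩,
      subEquiv_of_subLe (pushN_mono K a.hom h.le) (pushN_mono K a.hom h.ge)⟩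
  · intro x x' m m' _ hm'
    refine ⟨fun h => pushN_mono K a.hom h.arrow_left, fun h => hm'.subLe_of_left ?_⟩
    obtain ⟨D, r, hr⟩ := hm'.exists_isKer_left
    exact ((subLe_pullN_pushN K a.hom m.left).trans (pullN_mono K a.hom h)).trans
      (hr.pullN_pushN K).le
  · exact fun t _ ht => ⟨_, arrowOfLeft a (pullN K a.hom t),
      (K.isKer _).isNormalMonoN_arrowOfLeft, ht⟩
end
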